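/- For every integer k ≥ 2: for each n ∈ N the digit frequency set DF(n) is a nonempty compact subset of Δ, and the map n ↦ DF(n) from (N, d) to the space of nonempty compact subsets of Δ equipped with the Hausdorff metric is continuous. -/

import Mathlib

open Filter Topology
open scoped Classical

namespace BetaDF

/-- Digit sequences (elements of `Σ = {0,…,k−1}^ℕ` when all entries are `< k`). -/
abbrev Seq : Type := ℕ → ℕ

/-- Lexicographic (strict) order on digit sequences. -/
def seqLt (v w : Seq) : Prop := ∃ r, (∀ s, s < r → v s = w s) ∧ v r < w r

/-- Lexicographic order on digit sequences. -/
def seqLe (v w : Seq) : Prop := seqLt v w ∨ v = w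

/-- The shift map `σ`. -/
def shift (w : Seq) : Seq := fun r => w (r + 1)

/-- Membership in `Σ = {0,…,k−1}^ℕ`. -/
def InSigma (k : ℕ) (w : Seq) : Prop := ∀ r, w r < k

/-- A sequence is maximal if it is `≥` every element of its shift orbit. -/
def IsMaximal (w : Seq) : Prop := ∀ r, seqLe (shift^[r] w) w

/-- Number of occurrences of the digit `i` among the first `r` entries of `w`. -/
def digitCount (w : Seq) (i r : ℕ) : ℕ := ((Finset.range r).filter fun s => w s = i).card

/-- The ambient Euclidean space `ℝ^k`. -/
abbrev E (k : ℕ) : Type := EuclideanSpace ℝ (Fin k)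

/-- The `i`-th coordinate (with junk value `0` for `i ≥ k`). -/
def proj {k : ℕ} (α : E k) (i : ℕ) : ℝ := if h : i < k then α ⟨i, h⟩ else 0

/-- `w` has digit frequency vector `α`. -/
def HasDigitFreq (k : ℕ) (w : Seq) (α : E k) : Prop :=
  ∀ i, i < k →
    Tendsto (fun r => (digitCount w i r : ℝ) / (r : ℝ)) atTop (𝓝 (proj α i))

/-- The standard `(k−1)`-simplex `Δ`. -/
def simplex (k : ℕ) : Set (E k) := {α | (∀ i : Fin k, 0 ≤ α i) ∧ ∑ i, α i = 1}

/-- The face `F = {α ∈ Δ : α_{k−1} = 0}`. -/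
def faceF (k : ℕ) : Set (E k) := {α ∈ simplex k | proj α (k - 1) = 0}

/-- `Δ' = Δ ∖ F`. -/
def simplex' (k : ℕ) : Set (E k) := simplex k \ faceF k

/-- `J(α) = ⌊α₀/α_{k−1}⌋`. -/
noncomputable def Jfun {k : ℕ} (α : E k) : ℕ := ⌊proj α 0 / proj α (k - 1)⌋₊

/-- The map `K_n`. -/
noncomputable def Kmap {k : ℕ} (n : ℕ) (α : E k) : E k :=
  (WithLp.equiv 2 (Fin k → ℝ)).symm fun i =>
    if (i : ℕ) + 2 < k then proj α ((i : ℕ) + 1) / (1 - proj α 0)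
    else if (i : ℕ) + 2 = k then (proj α 0 - n * proj α (k - 1)) / (1 - proj α 0)
    else ((n + 1) * proj α (k - 1) - proj α 0) / (1 - proj α 0)

/-- The continued-fraction map `K : Δ' → Δ'`, `K(α) = K_{J(α)}(α)`. -/
noncomputable def Kstep {k : ℕ} (α : E k) : E k := Kmap (Jfun α) α

/-- The itinerary map `Φ(α)_r = J(K^r(α))`. -/
noncomputable def Phi {k : ℕ} (α : E k) : ℕ → ℕ := fun r => Jfun (Kstep^[r] α)

/-- The projective embedding `K_n^{-1} : Δ → Δ`. -/
noncomputable def Kinv {k : ℕ} (n : ℕ) (α : E k) : E k :=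
  (WithLp.equiv 2 (Fin k → ℝ)).symm fun i =>
    (if (i : ℕ) = 0 then (n + 1) * proj α (k - 2) + n * proj α (k - 1)
      else if (i : ℕ) + 1 = k then proj α (k - 2) + proj α (k - 1)
      else proj α ((i : ℕ) - 1)) /
      ((n + 1) * proj α (k - 2) + n * proj α (k - 1) + 1)

/-- `Υ_{n,r} = K_{n₀}^{-1} ∘ ⋯ ∘ K_{n_r}^{-1}`. -/
noncomputable def Ups {k : ℕ} (n : ℕ → ℕ) : ℕ → E k → E k
  | 0 => Kinv (n 0)
  | r + 1 => fun α => Ups n r (Kinv (n (r + 1)) α)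

/-- `A_{n,r} = Υ_{n,r}(Δ)`. -/
noncomputable def Anr (k : ℕ) (n : ℕ → ℕ) (r : ℕ) : Set (E k) := Ups n r '' simplex k

/-- `F_{n,r} = Υ_{n,r}(F)`. -/
noncomputable def Fnr (k : ℕ) (n : ℕ → ℕ) (r : ℕ) : Set (E k) := Ups n r '' faceF k

/-- Reverse-lexicographic strict order on `ℕ^ℕ`: `a < b` iff `a` exceeds `b`
at the first index where they differ. -/
def revLexLt (a b : ℕ → ℕ) : Prop := ∃ r, (∀ s, s < r → a s = b s) ∧ b r < a r

/-- The word to which the substitution `Λ_n` sends the digit `i`. -/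
def lamWord (k n i : ℕ) : List ℕ :=
  if i + 2 < k then [i + 1]
  else if i + 2 = k then (k - 1) :: List.replicate (n + 1) 0
  else (k - 1) :: List.replicate n 0

/-- The substitution `Λ_n : Σ → Σ`. -/
def lamSub (k n : ℕ) (w : Seq) : Seq := fun m =>
  (((List.range (m + 1)).map fun r => lamWord k n (w r)).flatten).getD m 0

/-- `Λ_{n,r} = Λ_{n₀} ∘ ⋯ ∘ Λ_{n_r}`. -/
def lamChain (k : ℕ) (n : ℕ → ℕ) : ℕ → Seq → Seq
  | 0 => lamSub k (n 0)
  | r + 1 => fun w => lamChain k n r (lamSub k (n (r + 1)) w)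

/-- `Λ_{n₀} ∘ ⋯ ∘ Λ_{n_{R−1}}` for a finite list of indices. -/
def lamList (k : ℕ) : List ℕ → Seq → Seq
  | [], w => w
  | a :: t, w => lamSub k a (lamList k t w)

/-- The constant sequence `(k−1)(k−1)(k−1)…`. -/
def topSeq (k : ℕ) : Seq := fun _ => k - 1

/-- The sequence `(k−1)000…`. -/
def baseSeq (k : ℕ) : Seq := fun m => if m = 0 then k - 1 else 0

/-- `S(n) = lim_{r→∞} Λ_{n,r}((k−1)(k−1)(k−1)…)` (limit in the product topology). -/
noncomputable def Sseq (k : ℕ) (n : ℕ → ℕ) : Seq :=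
  limUnder atTop fun r => lamChain k n r (topSeq k)

/-- The compactified itinerary space `N`: sequences with values in `ℕ∞` such that
all entries from the first `∞` onwards equal `∞`.  Elements with no `∞` entry
correspond to `ℕ^ℕ`; the others are the finite type elements `n₀…n_{R−1}∞`. -/
def NN : Type := {m : ℕ → ℕ∞ // ∀ r, m r = ⊤ → m (r + 1) = ⊤}

/-- Reverse-lexicographic strict order on `N` (`∞` counts as larger than every natural). -/
def nnLt (m n : NN) : Prop := ∃ r, (∀ s, s < r → m.1 s = n.1 s) ∧ n.1 r < m.1 r

/-- Reverse-lexicographic order on `N`. -/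
def nnLe (m n : NN) : Prop := nnLt m n ∨ m = n

/-- The element of `N` determined by an element of `ℕ^ℕ`. -/
def toNN (g : ℕ → ℕ) : NN := ⟨fun r => (g r : ℕ∞), fun r h => absurd h (by simp)⟩

/-- The itinerary `n₀ … n_{R−1} (n_R + 1) 0 0 0 …` (of rational type). -/
def ratSeq (f : ℕ → ℕ) (R : ℕ) : ℕ → ℕ := fun r =>
  if r < R then f r else if r = R then f R + 1 else 0

/-- The finite type element `n₀ … n_{R−1} n_R ∞` of `N`. -/
def finNN (f : ℕ → ℕ) (R : ℕ) : NN :=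
  ⟨fun r => if r ≤ R then (f r : ℕ∞) else ⊤, by
    intro r h
    show (if r + 1 ≤ R then ((f (r + 1) : ℕ∞)) else ⊤) = ⊤
    have h' : (if r ≤ R then ((f r : ℕ∞)) else ⊤) = ⊤ := h
    by_cases h1 : r ≤ R
    · rw [if_pos h1] at h'
      exact absurd h' (by simp)
    · rw [if_neg (by omega : ¬ r + 1 ≤ R)]⟩

/-- The extension of `S` to `N`. -/
noncomputable def SN (k : ℕ) (m : NN) : Seq :=
  if h : ∃ R, m.1 R = ⊤ then
    lamList k ((List.range (Nat.find h)).map fun r => (m.1 r).toNat) (baseSeq k)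
  else Sseq k fun r => (m.1 r).toNat

/-- The metric `d(m,n) = 2^{−X(m,n)}` on `N`, where
`X(m,n) = r + min(m₀+⋯+m_r, n₀+⋯+n_r)` and `r` is the first index where `m,n` differ. -/
noncomputable def dN (m n : NN) : ℝ :=
  if h : m = n then 0
  else
    have hex : ∃ r, m.1 r ≠ n.1 r := by
      by_contra hc
      push_neg at hc
      exact h (Subtype.ext (funext hc))
    (2 : ℝ) ^ (-(((Nat.find hex : ℕ) : ℤ) +
      ((min (∑ s ∈ Finset.range (Nat.find hex + 1), m.1 s)
            (∑ s ∈ Finset.range (Nat.find hex + 1), n.1 s)).toNat : ℤ)))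

/-- The symbolic β-shift `X(w)`. -/
def Xset (k : ℕ) (w : Seq) : Set Seq :=
  {v | InSigma k v ∧ ∀ r, seqLe (shift^[r] v) w}

/-- The digit frequency set `DF(w)` of the symbolic β-shift `X(w)`. -/
def DFw (k : ℕ) (w : Seq) : Set (E k) :=
  {α | α ∈ simplex k ∧ ∃ v ∈ Xset k w, HasDigitFreq k v α}

/-- `DF(n) = DF(S(n))` for `n ∈ ℕ^ℕ`. -/
noncomputable def DFn (k : ℕ) (n : ℕ → ℕ) : Set (E k) := DFw k (Sseq k n)

/-- `DF(n) = DF(S(n))` for `n ∈ N`. -/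
noncomputable def DFN (k : ℕ) (m : NN) : Set (E k) := DFw k (SN k m)

/-- The infimax map `I = S ∘ Φ` on `Δ'`, extended by `I(α) = (k−1)000…` on `F`. -/
noncomputable def Ifun (k : ℕ) (α : E k) : Seq :=
  if α ∈ simplex' k then Sseq k (Phi α) else baseSeq k

/-- The simplex `T_m = {α ∈ Δ : (m+1)α_{k−1} ≤ α₀}`. -/
def Tset (k m : ℕ) : Set (E k) :=
  {α ∈ simplex k | ((m : ℝ) + 1) * proj α (k - 1) ≤ proj α 0}

/-- The standard basis vector `e_i`. -/
noncomputable def evec (k i : ℕ) : E k :=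
  (WithLp.equiv 2 (Fin k → ℝ)).symm fun j => if (j : ℕ) = i then 1 else 0

/-- The rational extreme points
`FE(n) = {Υ_{n,s}(e_{k−2}) : n_{s+t} ≠ 0 for some 1 ≤ t ≤ k−2}`. -/
noncomputable def FEset (k : ℕ) (n : ℕ → ℕ) : Set (E k) :=
  {α | ∃ s, (∃ t, 1 ≤ t ∧ t ≤ k - 2 ∧ n (s + t) ≠ 0) ∧ α = Ups n s (evec k (k - 2))}

/-- The set `E(n)` of non-trivial extreme points of `DF(n)`:
extreme points other than `e₀,…,e_{k−2}`. -/
noncomputable def Eset (k : ℕ) (n : ℕ → ℕ) : Set (E k) :=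
  Set.extremePoints ℝ (DFn k n) \ {α | ∃ i, i ≤ k - 2 ∧ α = evec k i}

/-- The fiber `Φ^{-1}(n) ⊆ Δ'`. -/
noncomputable def PhiFiber (k : ℕ) (n : ℕ → ℕ) : Set (E k) :=
  {α ∈ simplex' k | Phi α = n}

/-- `f_β(x) = βx mod 1`. -/
noncomputable def fbeta (β x : ℝ) : ℝ := Int.fract (β * x)

/-- The digit sequence of the greedy β-expansion of `x`: `d_β(x)_r = ⌊β f_β^r(x)⌋`. -/
noncomputable def dbeta (β : ℝ) (x : ℝ) : Seq := fun r => ⌊β * (fbeta β)^[r] x⌋₊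

/-- The digit frequency set `DF(β)` of β-expansions of points of `[0,1]`. -/
noncomputable def DFbeta (k : ℕ) (β : ℝ) : Set (E k) :=
  {α | α ∈ simplex k ∧ ∃ x ∈ Set.Icc (0 : ℝ) 1, HasDigitFreq k (dbeta β x) α}

/-- The sequence `w_β`: if `d_β(1) = d₁…d_{r−1}d_r000…` with `d_r > 0` then `w_β`
is the infinite repetition of `d₁…d_{r−1}(d_r − 1)`; otherwise `w_β = d_β(1)`. -/
noncomputable def wbeta (β : ℝ) : Seq :=
  if h : ∃ r, dbeta β 1 r ≠ 0 ∧ ∀ s, r < s → dbeta β 1 s = 0 then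
    fun m =>
      if m % (Nat.find h + 1) = Nat.find h then dbeta β 1 (Nat.find h) - 1
      else dbeta β 1 (m % (Nat.find h + 1))
  else dbeta β 1

/-- `DF` extended to `[k−1,k]` by `DF(k−1) = F` and `DF(k) = Δ`. -/
noncomputable def DFext (k : ℕ) (β : ℝ) : Set (E k) :=
  if β ≤ (k : ℝ) - 1 then faceF k
  else if (k : ℝ) ≤ β then simplex k
  else DFbeta k β

/-- The mode-locking interval `I_{n₀…n_R}` determined by the word `f 0, …, f R`. -/
noncomputable def Iint (k : ℕ) (f : ℕ → ℕ) (R : ℕ) : Set ℝ :=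
  {β | (k : ℝ) - 1 < β ∧ β < k ∧
    seqLe (Sseq k (ratSeq f R)) (wbeta β) ∧ seqLe (wbeta β) (SN k (finNN f R))}

/-- The frequency vector of the first `s` digits of `w`. -/
noncomputable def freqVec (k : ℕ) (w : Seq) (s : ℕ) : E k :=
  (WithLp.equiv 2 (Fin k → ℝ)).symm fun i => (digitCount w (i : ℕ) s : ℝ) / (s : ℝ)



/-! ### Agreement of prefixes -/

def Agr (L : ℕ) (v w : Seq) : Prop := ∀ s, s < L → v s = w s

theorem Agr.symm' {L : ℕ} {v w : Seq} (h : Agr L v w) : Agr L w v := fun s hs => (h s hs).symm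
theorem Agr.trans' {L : ℕ} {u v w : Seq} (h : Agr L u v) (h' : Agr L v w) : Agr L u w :=
  fun s hs => (h s hs).trans (h' s hs)
theorem Agr.mono' {L M : ℕ} {v w : Seq} (h : Agr L v w) (hM : M ≤ L) : Agr M v w :=
  fun s hs => h s (lt_of_lt_of_le hs hM)

/-! ### The substitution -/

def preW (k n : ℕ) (w : Seq) (j : ℕ) : List ℕ :=
  ((List.range j).map fun r => lamWord k n (w r)).flatten

def headW (k i : ℕ) : ℕ := if i + 2 < k then i + 1 else k - 1

theorem lamWord_cons (k n i : ℕ) : ∃ t, lamWord k n i = headW k i :: t := by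
  unfold lamWord headW
  split_ifs <;> exact ⟨_, rfl⟩

theorem preW_succ (k n : ℕ) (w : Seq) (j : ℕ) :
    preW k n w (j + 1) = preW k n w j ++ lamWord k n (w j) := by
  simp [preW, List.range_succ]

theorem preW_congr (k n : ℕ) {v w : Seq} {j : ℕ} (h : Agr j v w) :
    preW k n v j = preW k n w j := by
  unfold preW
  congr 1
  apply List.map_congr_left
  intro r hr
  rw [h r (List.mem_range.1 hr)]

theorem preW_len (k n : ℕ) (w : Seq) (j : ℕ) : j ≤ (preW k n w j).length := by
  induction j with
  | zero => simp
  | succ j ih =>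
    obtain ⟨t, ht⟩ := lamWord_cons k n (w j)
    rw [preW_succ, ht]; simp; omega

theorem lamSub_eq (k n : ℕ) (w : Seq) (j : ℕ) :
    lamSub k n w j = if j < (preW k n w j).length then (preW k n w j).getD j 0
      else headW k (w j) := by
  have h : lamSub k n w j = (preW k n w (j + 1)).getD j 0 := rfl
  rw [h, preW_succ]
  split_ifs with hj
  · rw [List.getD_append _ _ _ _ hj]
  · have hl : (preW k n w j).length = j := le_antisymm (not_lt.1 hj) (preW_len k n w j)
    obtain ⟨t, ht⟩ := lamWord_cons k n (w j)
    rw [List.getD_append_right _ _ _ _ (by omega), hl, ht]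
    simp

theorem lamSub_agr (k n : ℕ) {v w : Seq} {L : ℕ} (h : Agr L v w) :
    Agr L (lamSub k n v) (lamSub k n w) := by
  intro s hs
  rw [lamSub_eq, lamSub_eq, preW_congr k n (h.mono' hs.le), h s hs]

def Good (k : ℕ) (v : Seq) : Prop := InSigma k v ∧ v 0 = k - 1

theorem lamWord_lt {k : ℕ} (hk : 2 ≤ k) (n i : ℕ) : ∀ a ∈ lamWord k n i, a < k := by
  intro a ha
  unfold lamWord at ha
  split_ifs at ha <;> simp at ha <;> omega

theorem preW_lt {k : ℕ} (hk : 2 ≤ k) (n : ℕ) (w : Seq) (j : ℕ) : ∀ a ∈ preW k n w j, a < k := by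
  intro a ha
  unfold preW at ha
  simp only [List.mem_flatten, List.mem_map] at ha
  obtain ⟨l, ⟨r, -, rfl⟩, h⟩ := ha
  exact lamWord_lt hk _ _ _ h

theorem lamSub_good {k : ℕ} (hk : 2 ≤ k) (n : ℕ) {v : Seq} (h : Good k v) :
    Good k (lamSub k n v) := by
  constructor
  · intro j
    rw [lamSub_eq]
    split_ifs with hj
    · rw [List.getD_eq_getElem _ _ hj]
      exact preW_lt hk _ _ _ _ (List.getElem_mem hj)
    · unfold headW; split_ifs <;> omega
  · rw [lamSub_eq]
    have := h.2
    simp [preW, headW, this]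
    omega

theorem lamList_good {k : ℕ} (hk : 2 ≤ k) (l : List ℕ) {v : Seq} (h : Good k v) :
    Good k (lamList k l v) := by
  induction l with
  | nil => exact h
  | cons a t ih => exact lamSub_good hk a ih

theorem lamList_agr (k : ℕ) (l : List ℕ) {v w : Seq} {L : ℕ} (h : Agr L v w) :
    Agr L (lamList k l v) (lamList k l w) := by
  induction l with
  | nil => exact h
  | cons a t ih => exact lamSub_agr k a ih

theorem lamList_append (k : ℕ) (l l' : List ℕ) (v : Seq) :
    lamList k (l ++ l') v = lamList k l (lamList k l' v) := by
  induction l with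
  | nil => rfl
  | cons a t ih => simp [lamList, ih]

theorem lamChain_eq (k : ℕ) (n : ℕ → ℕ) (r : ℕ) (w : Seq) :
    lamChain k n r w = lamList k ((List.range (r + 1)).map n) w := by
  induction r generalizing w with
  | zero => simp [lamChain, lamList, List.range_succ]
  | succ r ih =>
    rw [List.range_succ, List.map_append, lamList_append]
    simp only [lamChain, ih]
    rfl

def Q (j d : ℕ) (v w : Seq) : Prop := Agr j v w ∧ (v j = w j ∨ (d ≤ v j ∧ d ≤ w j))

theorem Q_step {k : ℕ} (n : ℕ) {j d : ℕ} {v w : Seq} (hd : d + 2 ≤ k) (h : Q j d v w) :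
    Q j (d + 1) (lamSub k n v) (lamSub k n w) := by
  refine ⟨lamSub_agr k n h.1, ?_⟩
  rw [lamSub_eq, lamSub_eq, preW_congr k n h.1]
  split_ifs
  · exact Or.inl rfl
  · rcases h.2 with h2 | ⟨h2, h3⟩
    · left; rw [h2]
    · right; unfold headW; constructor <;> split_ifs <;> omega

theorem Q_list {k : ℕ} (l : List ℕ) {j : ℕ} {v w : Seq} (h : Agr j v w) (hl : l.length + 1 ≤ k) :
    Q j l.length (lamList k l v) (lamList k l w) := by
  induction l with
  | nil => exact ⟨h, Or.inr ⟨Nat.zero_le _, Nat.zero_le _⟩⟩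
  | cons a t ih =>
    simp only [List.length_cons] at hl ⊢
    exact Q_step a (by omega) (ih (by omega))

theorem agr_of_length {k : ℕ} (hk : 2 ≤ k) (j : ℕ) : ∀ (l : List ℕ) {v w : Seq},
    Good k v → Good k w → j * (k - 1) ≤ l.length → Agr j (lamList k l v) (lamList k l w) := by
  induction j with
  | zero => intro l v w _ _ _ s hs; omega
  | succ j ih =>
    intro l v w hv hw hl
    have hl' : j * (k - 1) + (k - 1) ≤ l.length := by rw [← Nat.succ_mul]; exact hl
    have e : l = l.take (k - 1) ++ l.drop (k - 1) := (List.take_append_drop _ _).symm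
    have g1 := lamList_good hk l hv
    have g2 := lamList_good hk l hw
    have h1 := ih (l.drop (k - 1)) hv hw (by rw [List.length_drop]; omega)
    have hlen : (l.take (k - 1)).length = k - 1 := by rw [List.length_take]; omega
    have h2 := Q_list (k := k) (l.take (k - 1)) h1 (by omega)
    rw [← lamList_append, ← lamList_append, ← e, hlen] at h2
    intro s hs
    rcases Nat.lt_succ_iff_lt_or_eq.1 hs with h | rfl
    · exact h2.1 s h
    · have := g1.1 s
      have := g2.1 s
      rcases h2.2 with h | h <;> omega

/-! ### Continuity of `S` -/

def pre (m : NN) (r : ℕ) : List ℕ := (List.range r).map fun s => (m.1 s).toNat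

theorem pre_len (m : NN) (r : ℕ) : (pre m r).length = r := by simp [pre]

theorem pre_split (m : NN) {r R : ℕ} (h : r ≤ R) : ∃ l, pre m R = pre m r ++ l := by
  obtain ⟨b, rfl⟩ := Nat.exists_eq_add_of_le h
  unfold pre
  rw [List.range_add, List.map_append]
  exact ⟨_, rfl⟩

theorem pre_succ (m : NN) (r : ℕ) : pre m (r + 1) = pre m r ++ [(m.1 r).toNat] := by
  simp [pre, List.range_succ]

theorem base_good {k : ℕ} (hk : 2 ≤ k) : Good k (baseSeq k) := by
  constructor
  · intro r; unfold baseSeq; split_ifs <;> omega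
  · simp [baseSeq]

theorem top_good {k : ℕ} (hk : 2 ≤ k) : Good k (topSeq k) := by
  constructor
  · intro r; unfold topSeq; omega
  · simp [topSeq]

theorem Sseq_approx {k : ℕ} (hk : 2 ≤ k) (n : ℕ → ℕ) (L t : ℕ) (ht : L * (k - 1) ≤ t) :
    Agr L (Sseq k n) (lamList k ((List.range (t + 1)).map n) (topSeq k)) := by
  set a : ℕ → Seq := fun r => lamChain k n r (topSeq k) with ha
  have key : ∀ L t t', L * (k - 1) ≤ t → t ≤ t' → Agr L (a t) (a t') := by
    intro L t t' h h'
    obtain ⟨b, rfl⟩ := Nat.exists_eq_add_of_le h'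
    simp only [ha]
    rw [lamChain_eq, lamChain_eq, show t + b + 1 = (t + 1) + b by omega, List.range_add (n := t + 1) (m := b),
      List.map_append, lamList_append]
    exact agr_of_length hk L _ (top_good hk) (lamList_good hk _ (top_good hk)) (by rw [List.length_map, List.length_range]; omega)
  set l : Seq := fun p => a ((p + 1) * (k - 1)) p with hl
  have hlim : Tendsto a atTop (𝓝 l) := by
    rw [tendsto_pi_nhds]
    intro p
    apply tendsto_const_nhds.congr'
    filter_upwards [eventually_ge_atTop ((p + 1) * (k - 1))] with t ht
    exact key (p + 1) _ _ le_rfl ht p (by omega)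
  have hS : Sseq k n = l := hlim.limUnder_eq
  rw [hS, ← lamChain_eq]
  intro p hp
  exact key (p + 1) _ _ le_rfl (le_trans (Nat.mul_le_mul_right _ hp) ht) p (by omega)

theorem SN_approx {k : ℕ} (hk : 2 ≤ k) (m : NN) (r : ℕ) (hr : ∀ s, s < r → m.1 s ≠ ⊤) (L : ℕ) :
    ∃ v, Good k v ∧ Agr L (SN k m) (lamList k (pre m r) v) := by
  unfold SN
  split_ifs with h
  · have hR : r ≤ Nat.find h := by
      by_contra hc
      exact hr _ (not_le.1 hc) (Nat.find_spec h)
    obtain ⟨l, hl⟩ := pre_split m hR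
    refine ⟨lamList k l (baseSeq k), lamList_good hk _ (base_good hk), ?_⟩
    rw [← lamList_append, ← hl]
    exact fun s _ => rfl
  · obtain ⟨l, hl⟩ := pre_split m (show r ≤ (L * (k - 1) + r) + 1 by omega)
    refine ⟨lamList k l (topSeq k), lamList_good hk _ (top_good hk), ?_⟩
    rw [← lamList_append, ← hl]
    exact Sseq_approx hk _ L _ (by omega)

theorem SN_zero {k : ℕ} (hk : 2 ≤ k) (m : NN) : 0 < SN k m 0 := by
  obtain ⟨v, hv, h⟩ := SN_approx hk m 0 (by intro s hs; omega) 1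
  rw [h 0 (by omega)]
  have := (lamList_good hk (pre m 0) hv).2
  omega

theorem dN_spec {m' m : NN} (hne : m' ≠ m) {M : ℕ} (h : dN m' m < (2 : ℝ) ^ (-(M : ℤ))) :
    ∃ r, (∀ s, s < r → m'.1 s = m.1 s) ∧ m'.1 r ≠ m.1 r ∧
      M < r + (min (∑ s ∈ Finset.range (r + 1), m'.1 s)
        (∑ s ∈ Finset.range (r + 1), m.1 s)).toNat := by
  unfold dN at h
  rw [dif_neg hne] at h
  have hex : ∃ r, m'.1 r ≠ m.1 r := by
    by_contra hc
    push Not at hc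
    exact hne (Subtype.ext (funext hc))
  refine ⟨Nat.find hex, ?_, Nat.find_spec hex, ?_⟩
  · intro s hs
    exact not_not.1 (Nat.find_min hex hs)
  · have h2 := (zpow_lt_zpow_iff_right₀ (by norm_num : (1 : ℝ) < 2)).1 h
    omega

theorem sum_fin (m : NN) (r : ℕ) (h : ∀ s, s < r → m.1 s ≠ ⊤) :
    ∑ s ∈ Finset.range r, m.1 s = ((∑ s ∈ Finset.range r, (m.1 s).toNat : ℕ) : ℕ∞) := by
  rw [Nat.cast_sum]
  apply Finset.sum_congr rfl
  intro s hs
  exact (ENat.coe_toNat (h s (Finset.mem_range.1 hs))).symm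

theorem min_toNat_le (a : ℕ∞) (b c : ℕ) (h : b ≤ c) : (min a (b : ℕ∞)).toNat ≤ c := by
  have : min a (b : ℕ∞) ≤ (c : ℕ∞) := le_trans (min_le_right _ _) (by exact_mod_cast h)
  exact ENat.toNat_le_of_le_coe this

theorem pre_congr {m m' : NN} {r : ℕ} (h : ∀ s, s < r → m'.1 s = m.1 s) : pre m' r = pre m r := by
  unfold pre
  apply List.map_congr_left
  intro s hs
  rw [h s (List.mem_range.1 hs)]

theorem base_agr {k : ℕ} (hk : 2 ≤ k) (n : ℕ) {v : Seq} (hv : v 0 = k - 1) :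
    Agr (n + 1) (baseSeq k) (lamSub k n v) := by
  intro s hs
  have h1 : preW k n v 1 = (k - 1) :: List.replicate n 0 := by
    simp [preW, List.range_succ, hv, lamWord]
    rw [if_neg (by omega), if_neg (by omega)]
  have h2 : lamSub k n v s = (preW k n v (s + 1)).getD s 0 := rfl
  have h3 : preW k n v (s + 1) = preW k n v 1 ++
      ((List.range s).map fun r => lamWord k n (v (1 + r))).flatten := by
    unfold preW
    rw [show s + 1 = 1 + s by omega, List.range_add, List.map_append, List.flatten_append,
      List.map_map]
    rfl
  rw [h2, h3, h1, List.getD_append _ _ _ _ (by simp; omega)]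
  unfold baseSeq
  cases s with
  | zero => simp
  | succ s => simp

theorem NN_top (m : NN) {R s : ℕ} (h : m.1 R = ⊤) (hs : R ≤ s) : m.1 s = ⊤ := by
  induction s, hs using Nat.le_induction with
  | base => exact h
  | succ s _ ih => exact m.2 s ih

theorem SN_cont {k : ℕ} (hk : 2 ≤ k) (m : NN) (L : ℕ) :
    ∃ δ > (0 : ℝ), ∀ m' : NN, dN m' m < δ → Agr L (SN k m') (SN k m) := by
  by_cases hT : ∃ R, m.1 R = ⊤
  · set R := Nat.find hT with hR
    have hRt : m.1 R = ⊤ := Nat.find_spec hT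
    have hRf : ∀ s, s < R → m.1 s ≠ ⊤ := fun s hs => Nat.find_min hT hs
    set A := ∑ s ∈ Finset.range R, (m.1 s).toNat with hA
    refine ⟨(2 : ℝ) ^ (-((R + A + L : ℕ) : ℤ)), by positivity, ?_⟩
    intro m' hd
    by_cases hne : m' = m
    · subst hne; exact fun s _ => rfl
    obtain ⟨r, hr1, hr2, hr3⟩ := dN_spec hne hd
    rcases lt_trichotomy r R with hlt | heq | hgt
    · exfalso
      have h1 : ∑ s ∈ Finset.range (r + 1), (m.1 s).toNat ≤ A :=
        Finset.sum_le_sum_of_subset (Finset.range_mono (by omega))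
      rw [sum_fin m (r + 1) (fun s hs => hRf s (by omega))] at hr3
      have := min_toNat_le (∑ s ∈ Finset.range (r + 1), m'.1 s) _ _ h1
      omega
    · have hne' : m'.1 R ≠ ⊤ := by
        rw [heq, hRt] at hr2; exact hr2
      rw [heq] at hr1
      have hf' : ∀ s, s < R + 1 → m'.1 s ≠ ⊤ := by
        intro s hs
        rcases Nat.lt_succ_iff_lt_or_eq.1 hs with h | rfl
        · rw [hr1 s h]; exact hRf s h
        · exact hne'
      have hbig : L < (m'.1 R).toNat := by
        have hA' : ∑ s ∈ Finset.range R, (m'.1 s).toNat = A := by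
          apply Finset.sum_congr rfl
          intro s hs; rw [hr1 s (Finset.mem_range.1 hs)]
        have h2 := sum_fin m' (R + 1) hf'
        rw [heq, min_comm, h2] at hr3
        have h3 := min_toNat_le (∑ s ∈ Finset.range (R + 1), m.1 s) _ _
          (le_refl (∑ s ∈ Finset.range (R + 1), (m'.1 s).toNat))
        rw [Finset.sum_range_succ (fun s => (m'.1 s).toNat), hA'] at h3 hr3
        omega
      obtain ⟨v, hv, hv'⟩ := SN_approx hk m' (R + 1) hf' L
      have hm : SN k m = lamList k (pre m R) (baseSeq k) := by
        unfold SN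
        rw [dif_pos hT]
        rfl
      rw [hm]
      refine hv'.trans' ?_
      rw [pre_succ, lamList_append, pre_congr hr1]
      apply lamList_agr
      exact ((base_agr hk _ hv.2).mono' (by omega)).symm'
    · exfalso
      apply hr2
      rw [NN_top m hRt hgt.le, NN_top m' (R := R) (by rw [hr1 R hgt, hRt]) hgt.le]
  · push Not at hT
    set P := L * (k - 1) with hP
    set A := ∑ s ∈ Finset.range P, (m.1 s).toNat with hA
    refine ⟨(2 : ℝ) ^ (-((P + A : ℕ) : ℤ)), by positivity, ?_⟩
    intro m' hd
    by_cases hne : m' = m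
    · subst hne; exact fun s _ => rfl
    obtain ⟨r, hr1, hr2, hr3⟩ := dN_spec hne hd
    have hr : P ≤ r := by
      by_contra hc
      have h1 : ∑ s ∈ Finset.range (r + 1), (m.1 s).toNat ≤ A :=
        Finset.sum_le_sum_of_subset (Finset.range_mono (by omega))
      rw [sum_fin m (r + 1) (fun s hs => hT s)] at hr3
      have := min_toNat_le (∑ s ∈ Finset.range (r + 1), m'.1 s) _ _ h1
      omega
    obtain ⟨v, hv, h1⟩ := SN_approx hk m' r (fun s hs => by rw [hr1 s hs]; exact hT s) L
    obtain ⟨v', hv', h2⟩ := SN_approx hk m r (fun s hs => hT s) L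
    rw [pre_congr hr1] at h1
    refine h1.trans' (Agr.trans' ?_ h2.symm')
    exact agr_of_length hk L _ hv hv' (by rw [pre_len]; exact hr)

/-! ### Digit counts -/

theorem digitCount_succ (w : Seq) (i r : ℕ) :
    digitCount w i (r + 1) = digitCount w i r + if w r = i then 1 else 0 := by
  unfold digitCount
  rw [Finset.range_add_one, Finset.filter_insert]
  split_ifs
  · rw [Finset.card_insert_of_notMem (by simp)]
  · rfl

theorem digitCount_add (w : Seq) (i a b : ℕ) :
    digitCount w i (a + b) = digitCount w i a + digitCount (fun s => w (a + s)) i b := by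
  induction b with
  | zero => simp [digitCount]
  | succ b ih => rw [← add_assoc, digitCount_succ, ih, digitCount_succ, add_assoc]

theorem digitCount_congr {v w : Seq} {N : ℕ} (i : ℕ) (h : Agr N v w) :
    digitCount v i N = digitCount w i N := by
  unfold digitCount
  congr 1
  apply Finset.filter_congr
  intro s hs
  rw [h s (Finset.mem_range.1 hs)]

theorem digitCount_le (w : Seq) (i N : ℕ) : digitCount w i N ≤ N := by
  unfold digitCount
  exact (Finset.card_filter_le _ _).trans (by simp)

theorem digitCount_le_of_ne {f g : Seq} {p : ℕ} (h : ∀ s, s ≠ p → f s = g s) (i N : ℕ) :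
    digitCount f i N ≤ digitCount g i N + 1 := by
  unfold digitCount
  refine le_trans (Finset.card_le_card ?_) (Finset.card_insert_le p _)
  intro s hs
  simp only [Finset.mem_filter, Finset.mem_insert] at hs ⊢
  by_cases hp : s = p
  · exact Or.inl hp
  · right; rw [← h s hp]; exact hs

theorem sum_digitCount {k : ℕ} (w : Seq) (N : ℕ) (h : ∀ s, s < N → w s < k) :
    ∑ i : Fin k, digitCount w (i : ℕ) N = N := by
  induction N with
  | zero => simp [digitCount]
  | succ N ih =>
    simp only [digitCount_succ, Finset.sum_add_distrib]
    rw [ih (fun s hs => h s (by omega))]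
    congr 1
    have := h N (by omega)
    rw [Finset.sum_eq_single (⟨w N, this⟩ : Fin k)]
    · simp
    · intro b _ hb
      rw [if_neg]
      intro hc
      exact hb (Fin.ext hc.symm)
    · simp

/-- Strictly admissible words. -/
def Str (k : ℕ) (w f : Seq) (N : ℕ) : Prop :=
  (∀ r, r < N → f r < k) ∧
  ∀ r, r < N → ∃ s, r + s < N ∧ (∀ t, t < s → f (r + t) = w t) ∧ f (r + s) < w s

theorem exists_concat (x : ℕ → Seq) (l : ℕ → ℕ) :
    ∃ v : Seq, ∀ t i, i < l t → v (∑ s ∈ Finset.range t, l s + i) = x t i := by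
  set T : ℕ → ℕ := fun t => ∑ s ∈ Finset.range t, l s with hT
  have hmono : Monotone T := by
    apply monotone_nat_of_le_succ
    intro n; simp [hT, Finset.sum_range_succ]
  refine ⟨fun m => if h : ∃ t i, i < l t ∧ T t + i = m then
    x h.choose h.choose_spec.choose else 0, ?_⟩
  intro t i hi
  have h : ∃ t' i', i' < l t' ∧ T t' + i' = T t + i := ⟨t, i, hi, rfl⟩
  show (if h : ∃ t' i', i' < l t' ∧ T t' + i' = T t + i then
    x h.choose h.choose_spec.choose else 0) = x t i
  rw [dif_pos h]
  obtain ⟨h1, h2⟩ := h.choose_spec.choose_spec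
  generalize h.choose_spec.choose = i' at h1 h2 ⊢
  generalize h.choose = t' at h1 h2 ⊢
  have hs : ∀ t, T (t + 1) = T t + l t := fun t => by simp [hT, Finset.sum_range_succ]
  have : t' = t := by
    rcases lt_trichotomy t' t with hlt | h | hlt
    · have := hmono (show t' + 1 ≤ t from hlt)
      rw [hs] at this; omega
    · exact h
    · have := hmono (show t + 1 ≤ t' from hlt)
      rw [hs] at this; omega
  subst this
  have : i' = i := by omega
  rw [this]

theorem exists_pos (l : ℕ → ℕ) (hl : ∀ t, 0 < l t) (m : ℕ) :
    ∃ t i, i < l t ∧ m = ∑ s ∈ Finset.range t, l s + i := by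
  induction m with
  | zero => exact ⟨0, 0, hl 0, by simp⟩
  | succ m ih =>
    obtain ⟨t, i, hi, rfl⟩ := ih
    by_cases h : i + 1 < l t
    · exact ⟨t, i + 1, h, by omega⟩
    · refine ⟨t + 1, 0, hl _, ?_⟩
      rw [Finset.sum_range_succ]; omega

theorem shift_iter (r : ℕ) (v : Seq) (s : ℕ) : shift^[r] v s = v (r + s) := by
  induction r generalizing v with
  | zero => simp
  | succ r ih =>
    rw [Function.iterate_succ, Function.comp, ih]
    unfold shift
    congr 1; omega

theorem proj_nonneg {k : ℕ} {α : E k} (h : α ∈ simplex k) (i : ℕ) : 0 ≤ proj α i := by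
  unfold proj
  split_ifs
  · exact h.1 _
  · exact le_rfl

theorem coord_le_one {k : ℕ} {α : E k} (h : α ∈ simplex k) (i : Fin k) : α i ≤ 1 := by
  rw [← h.2]
  exact Finset.single_le_sum (f := fun i => α i) (fun j _ => h.1 j) (Finset.mem_univ i)

theorem proj_le_one {k : ℕ} {α : E k} (h : α ∈ simplex k) (i : ℕ) : proj α i ≤ 1 := by
  unfold proj
  split_ifs
  · exact coord_le_one h _
  · exact zero_le_one

theorem concat_freq {a : ℝ} (ha0 : 0 ≤ a) (ha1 : a ≤ 1) (i : ℕ) (x : ℕ → Seq) (l : ℕ → ℕ)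
    (hl : ∀ t, 0 < l t) (v : Seq)
    (hv : ∀ t i, i < l t → v (∑ s ∈ Finset.range t, l s + i) = x t i)
    (hdev : ∀ ε > (0 : ℝ), ∃ t0, ∀ t, t0 ≤ t →
      |(digitCount (x t) i (l t) : ℝ) - l t * a| ≤ ε * l t ∧ (l t : ℝ) ≤ ε * t) :
    Tendsto (fun r => (digitCount v i r : ℝ) / (r : ℝ)) atTop (𝓝 a) := by
  set T : ℕ → ℕ := fun t => ∑ s ∈ Finset.range t, l s with hT
  have hs : ∀ t, T (t + 1) = T t + l t := fun t => by simp [hT, Finset.sum_range_succ]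
  have htT : ∀ t, t ≤ T t := by
    intro t
    induction t with
    | zero => simp
    | succ t ih => rw [hs]; have := hl t; omega
  have hD : ∀ t j, j ≤ l t → digitCount v i (T t + j) = digitCount v i (T t) + digitCount (x t) i j := by
    intro t j hj
    rw [digitCount_add]
    congr 1
    exact digitCount_congr i (fun s hs => hv t s (by omega))
  have hbd : ∀ (f : Seq) (N : ℕ), |(digitCount f i N : ℝ) - N * a| ≤ N := by
    intro f N
    have h1 : (digitCount f i N : ℝ) ≤ N := by exact_mod_cast digitCount_le f i N
    have h2 : (0 : ℝ) ≤ digitCount f i N := Nat.cast_nonneg _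
    have h3 : (0 : ℝ) ≤ N := Nat.cast_nonneg _
    rw [abs_le]; constructor <;> nlinarith
  rw [Metric.tendsto_atTop]
  intro ε hε
  obtain ⟨t0, ht0⟩ := hdev (ε / 4) (by positivity)
  have hmain : ∀ t, t0 ≤ t → |(digitCount v i (T t) : ℝ) - T t * a| ≤ T t0 + ε / 4 * T t := by
    intro t ht
    induction t, ht using Nat.le_induction with
    | base =>
      have := hbd v (T t0)
      have : (0 : ℝ) ≤ ε / 4 * T t0 := by positivity
      linarith
    | succ t ht ih =>
      rw [hs, hD t _ le_rfl]
      have h1 := (ht0 t ht).1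
      push_cast
      have e : (digitCount v i (T t) : ℝ) + digitCount (x t) i (l t) - (T t + l t) * a =
        ((digitCount v i (T t) : ℝ) - T t * a) + ((digitCount (x t) i (l t) : ℝ) - l t * a) := by ring
      rw [e]
      refine (abs_add_le _ _).trans ?_
      linarith
  obtain ⟨n0, hn0⟩ := exists_nat_gt ((T t0 : ℝ) / (ε / 4))
  refine ⟨max (n0 + 1) (T t0 + 1), ?_⟩
  intro r hr
  obtain ⟨t, j, hj, hrt⟩ := exists_pos l hl r
  have hrt' : r = T t + j := hrt
  have htt : t0 ≤ t := by
    by_contra hc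
    have : T (t + 1) ≤ T t0 := by
      apply Finset.sum_le_sum_of_subset
      exact Finset.range_mono (by omega)
    rw [hs] at this
    have := le_max_right (n0 + 1) (T t0 + 1)
    omega
  have hr0 : (0 : ℝ) < r := by
    have := le_max_left (n0 + 1) (T t0 + 1)
    exact_mod_cast (by omega : 0 < r)
  have hrn : (n0 : ℝ) ≤ r := by
    have := le_max_left (n0 + 1) (T t0 + 1)
    exact_mod_cast (by omega : n0 ≤ r)
  have hTe : (T t0 : ℝ) < ε / 4 * r := by
    rw [div_lt_iff₀ (by positivity)] at hn0
    nlinarith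
  have h1 := hmain t htt
  have h2 := (ht0 t htt).2
  have h3 := hbd (x t) j
  have h4 := hD t j hj.le
  have h5 : (T t : ℝ) ≤ r := by exact_mod_cast (by omega : T t ≤ r)
  have h6 : (t : ℝ) ≤ r := by exact_mod_cast (by have := htT t; omega : t ≤ r)
  have h7 : (j : ℝ) ≤ l t := by exact_mod_cast hj.le
  have h8 : |(digitCount v i r : ℝ) - r * a| < ε * r := by
    rw [hrt', h4]
    push_cast
    have e : (digitCount v i (T t) : ℝ) + digitCount (x t) i j - (T t + j) * a =
        ((digitCount v i (T t) : ℝ) - T t * a) + ((digitCount (x t) i j : ℝ) - j * a) := by ring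
    rw [e]
    refine lt_of_le_of_lt (abs_add_le _ _) ?_
    have h9 : (T t : ℝ) + j = r := by rw [hrt']; push_cast; ring
    rw [h9]
    nlinarith
  rw [Real.dist_eq]
  have e : (digitCount v i r : ℝ) / r - a = ((digitCount v i r : ℝ) - r * a) / r := by
    field_simp
  rw [e, abs_div, abs_of_pos hr0, div_lt_iff₀ hr0]
  exact h8

theorem close_mem {k : ℕ} (w : Seq) {α : E k} (hα : α ∈ simplex k)
    (h : ∀ ε > (0 : ℝ), ∃ u N, 0 < N ∧ Str k w u N ∧
      ∀ i, i < k → |(digitCount u i N : ℝ) - N * proj α i| ≤ ε * N) : α ∈ DFw k w := by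
  have h' : ∀ j : ℕ, ∃ u N, 0 < N ∧ Str k w u N ∧
      ∀ i, i < k → |(digitCount u i N : ℝ) - N * proj α i| ≤ (1 / ((j : ℝ) + 1)) * N :=
    fun j => h _ (by positivity)
  choose u N hN hS hdev using h'
  set J : ℕ → ℕ := fun t => Nat.findGreatest (fun j => j * N j ≤ t) t with hJ
  have hJ1 : ∀ t, J t * N (J t) ≤ t := by
    intro t
    exact Nat.findGreatest_spec (P := fun j => j * N j ≤ t) (Nat.zero_le t) (by simp)
  have hJ2 : ∀ j t, j ≤ t → j * N j ≤ t → j ≤ J t := by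
    intro j t h1 h2
    exact Nat.le_findGreatest h1 h2
  have hpos : ∀ t, 0 < N (J t) := fun t => hN _
  obtain ⟨v, hv⟩ := exists_concat (fun t => u (J t)) (fun t => N (J t))
  refine ⟨hα, v, ⟨?_, ?_⟩, ?_⟩
  · intro r
    obtain ⟨t, i, hi, rfl⟩ := exists_pos _ hpos r
    rw [hv t i hi]
    exact (hS _).1 i hi
  · intro r
    obtain ⟨t, i, hi, rfl⟩ := exists_pos _ hpos r
    obtain ⟨s, hs1, hs2, hs3⟩ := (hS (J t)).2 i hi
    left
    refine ⟨s, ?_, ?_⟩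
    · intro q hq
      rw [shift_iter, add_assoc, hv t _ (by omega)]
      exact hs2 q hq
    · rw [shift_iter, add_assoc, hv t _ (by omega)]
      exact hs3
  · intro i hi
    refine concat_freq (proj_nonneg hα i) (proj_le_one hα i) i _ _ hpos v hv ?_
    intro ε hε
    obtain ⟨j, hj⟩ := exists_nat_gt (1 / ε)
    refine ⟨max j (j * N j), ?_⟩
    intro t ht
    have h1 : j ≤ J t := hJ2 j t (le_trans (le_max_left _ _) ht) (le_trans (le_max_right _ _) ht)
    have h2 : (j : ℝ) ≤ J t := by exact_mod_cast h1
    have h3 : 1 < ε * J t := by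
      rw [div_lt_iff₀ hε] at hj
      nlinarith
    have h0 : (0 : ℝ) < J t := by
      by_contra hc
      nlinarith
    constructor
    · refine (hdev (J t) i hi).trans ?_
      apply mul_le_mul_of_nonneg_right _ (Nat.cast_nonneg _)
      rw [div_le_iff₀ (by positivity)]
      nlinarith
    · have h4 : (J t : ℝ) * N (J t) ≤ t := by exact_mod_cast hJ1 t
      have h5 : (0 : ℝ) ≤ N (J t) := Nat.cast_nonneg _
      nlinarith [mul_le_mul_of_nonneg_left h4 hε.le]

theorem block {k : ℕ} {w f : Seq} (hw : 0 < w 0) (L : ℕ) (hf : ∀ r, r < L → f r < k)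
    (h : ∀ r, r < L → (∃ s, r + s < L ∧ (∀ t, t < s → f (r + t) = w t) ∧ f (r + s) < w s) ∨
      ∀ t, r + t < L → f (r + t) = w t) :
    ∃ g, Str k w g L ∧ ∀ i, digitCount g i L ≤ digitCount f i L + 1 ∧
      digitCount f i L ≤ digitCount g i L + 1 := by
  by_cases hz : ∀ r, r < L → f r = 0
  · refine ⟨f, ⟨hf, ?_⟩, fun i => by omega⟩
    intro r hr
    exact ⟨0, by omega, by intro t ht; omega, by rw [add_zero, hz r hr]; exact hw⟩
  · push Not at hz
    obtain ⟨p0, hp0, hp0'⟩ := hz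
    set p := Nat.findGreatest (fun r => r < L ∧ f r ≠ 0) L with hp
    have hpS : p < L ∧ f p ≠ 0 :=
      Nat.findGreatest_spec (P := fun r => r < L ∧ f r ≠ 0) hp0.le ⟨hp0, hp0'⟩
    have hpM : ∀ r, p < r → r < L → f r = 0 := by
      intro r h1 h2
      by_contra hc
      have := Nat.le_findGreatest (P := fun r => r < L ∧ f r ≠ 0) h2.le ⟨h2, hc⟩
      omega
    refine ⟨Function.update f p (f p - 1), ⟨?_, ?_⟩, ?_⟩
    · intro r hr
      have := hf r hr
      by_cases e : r = p
      · subst e; rw [Function.update_self]; omega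
      · rw [Function.update_of_ne e]; exact this
    · intro r hr
      by_cases hrp : p < r
      · refine ⟨0, by omega, by intro t ht; omega, ?_⟩
        rw [add_zero, Function.update_of_ne (by omega), hpM r hrp hr]
        exact hw
      · by_cases hex : ∃ s, r + s < p ∧ (∀ t, t < s → f (r + t) = w t) ∧ f (r + s) < w s
        · obtain ⟨s, h1, h2, h3⟩ := hex
          refine ⟨s, by omega, ?_, ?_⟩
          · intro t ht
            rw [Function.update_of_ne (by omega)]; exact h2 t ht
          · rw [Function.update_of_ne (by omega)]; exact h3
        · have key : (∀ t, r + t < p → f (r + t) = w t) ∧ f p ≤ w (p - r) := by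
            rcases h r hr with ⟨s, h1, h2, h3⟩ | h1
            · have hsp : p ≤ r + s := by
                by_contra hc
                exact hex ⟨s, by omega, h2, h3⟩
              refine ⟨fun t ht => h2 t (by omega), ?_⟩
              rcases hsp.lt_or_eq with h4 | h4
              · have := h2 (p - r) (by omega)
                rw [show r + (p - r) = p by omega] at this
                exact this.le
              · rw [show p - r = s by omega, h4]
                exact h3.le
            · refine ⟨fun t ht => h1 t (by omega), ?_⟩
              have := h1 (p - r) (by omega)
              rw [show r + (p - r) = p by omega] at this
              exact this.le
          refine ⟨p - r, by omega, ?_, ?_⟩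
          · intro t ht
            rw [Function.update_of_ne (by omega)]
            exact key.1 t (by omega)
          · rw [show r + (p - r) = p by omega, Function.update_self]
            have := key.2
            have := hpS.2
            omega
    · intro i
      constructor
      · exact digitCount_le_of_ne (p := p) (fun s hs => Function.update_of_ne hs _ _) i L
      · exact digitCount_le_of_ne (p := p) (fun s hs => (Function.update_of_ne hs _ _).symm) i L

theorem blocks {k : ℕ} {w w' v : Seq} (hw : 0 < w 0) {L : ℕ} (hL : 0 < L) (ha : Agr L w' w)
    (hv : v ∈ Xset k w') :
    ∃ g, ∀ q, Str k w g (q * L) ∧ ∀ i, digitCount g i (q * L) ≤ digitCount v i (q * L) + q ∧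
      digitCount v i (q * L) ≤ digitCount g i (q * L) + q := by
  have hb : ∀ q : ℕ, ∃ g, Str k w g L ∧
      ∀ i, digitCount g i L ≤ digitCount (fun s => v (q * L + s)) i L + 1 ∧
      digitCount (fun s => v (q * L + s)) i L ≤ digitCount g i L + 1 := by
    intro q
    apply block hw L (fun r _ => hv.1 _)
    intro r hr
    rcases hv.2 (q * L + r) with ⟨s, h1, h2⟩ | h1
    · by_cases hs : r + s < L
      · left
        refine ⟨s, hs, ?_, ?_⟩
        · intro t ht
          have := h1 t ht
          rw [shift_iter, ha t (by omega), add_assoc] at this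
          exact this
        · rw [shift_iter, ha s (by omega), add_assoc] at h2
          exact h2
      · right
        intro t ht
        have := h1 t (by omega)
        rw [shift_iter, ha t (by omega), add_assoc] at this
        exact this
    · right
      intro t ht
      have := congrFun h1 t
      rw [shift_iter, ha t (by omega), add_assoc] at this
      exact this
  choose x hx1 hx2 using hb
  obtain ⟨g, hg⟩ := exists_concat x (fun _ => L)
  have hg' : ∀ q i, i < L → g (q * L + i) = x q i := by
    intro q i hi
    have := hg q i hi
    simpa using this
  refine ⟨g, ?_⟩
  intro q
  have hdec : ∀ r, r < q * L → ∃ t i, t < q ∧ i < L ∧ r = t * L + i := by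
    intro r hr
    refine ⟨r / L, r % L, Nat.div_lt_of_lt_mul (by rwa [mul_comm]), Nat.mod_lt _ hL, ?_⟩
    rw [mul_comm]; exact (Nat.div_add_mod r L).symm
  have hle : ∀ t, t < q → t * L + L ≤ q * L := by
    intro t ht
    rw [← Nat.succ_mul]
    exact Nat.mul_le_mul_right _ ht
  refine ⟨⟨?_, ?_⟩, ?_⟩
  · intro r hr
    obtain ⟨t, i, ht, hi, rfl⟩ := hdec r hr
    rw [hg' t i hi]
    exact (hx1 t).1 i hi
  · intro r hr
    obtain ⟨t, i, ht, hi, rfl⟩ := hdec r hr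
    obtain ⟨s, h1, h2, h3⟩ := (hx1 t).2 i hi
    have := hle t ht
    refine ⟨s, by omega, ?_, ?_⟩
    · intro u hu
      rw [add_assoc, hg' t _ (by omega)]
      exact h2 u hu
    · rw [add_assoc, hg' t _ (by omega)]
      exact h3
  · intro i
    clear hdec hle
    induction q with
    | zero => simp [digitCount]
    | succ q ih =>
      rw [Nat.succ_mul, digitCount_add, digitCount_add]
      rw [digitCount_congr i (show Agr L (fun s => g (q * L + s)) (x q) from fun s hs => hg' q s hs)]
      have := hx2 q i
      omega

theorem exists_dev {k : ℕ} {w w' v : Seq} (hw : 0 < w 0) {L : ℕ} (hL : 0 < L) (ha : Agr L w' w)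
    (hv : v ∈ Xset k w') {α : E k} (hα : HasDigitFreq k v α) {η : ℝ} (hη : 0 < η) :
    ∃ u N, 0 < N ∧ Str k w u N ∧
      ∀ i, i < k → |(digitCount u i N : ℝ) - N * proj α i| ≤ (1 / L + η) * N := by
  obtain ⟨g, hg⟩ := blocks hw hL ha hv
  have h1 : ∀ᶠ r : ℕ in atTop, ∀ i : Fin k,
      |(digitCount v (i : ℕ) r : ℝ) / r - proj α i| < η := by
    rw [eventually_all]
    intro i
    have := (hα i i.2).eventually (Metric.ball_mem_nhds _ hη)
    filter_upwards [this] with r hr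
    rwa [Real.dist_eq] at hr
  obtain ⟨r0, hr0⟩ := eventually_atTop.1 h1
  have hN : r0 < (r0 + 1) * L := by nlinarith
  refine ⟨g, (r0 + 1) * L, by omega, (hg _).1, ?_⟩
  intro i hi
  have h2 := hr0 _ hN.le ⟨i, hi⟩
  obtain ⟨h3, h4⟩ := (hg (r0 + 1)).2 i
  have hNpos : (0 : ℝ) < (((r0 + 1) * L : ℕ) : ℝ) := by exact_mod_cast (by omega)
  have hLpos : (0 : ℝ) < L := by exact_mod_cast hL
  have hq : (1 / (L : ℝ)) * (((r0 + 1) * L : ℕ) : ℝ) = ((r0 + 1 : ℕ) : ℝ) := by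
    push_cast; field_simp
  generalize hNN : (r0 + 1) * L = N at *
  have h3' : (digitCount g i N : ℝ) ≤ digitCount v i N + ((r0 + 1 : ℕ) : ℝ) := by exact_mod_cast h3
  have h4' : (digitCount v i N : ℝ) ≤ digitCount g i N + ((r0 + 1 : ℕ) : ℝ) := by exact_mod_cast h4
  have h5 : |(digitCount v i N : ℝ) - N * proj α i| ≤ η * N := by
    have e : (digitCount v i N : ℝ) - N * proj α i =
      ((digitCount v i N : ℝ) / N - proj α i) * N := by field_simp
    rw [e, abs_mul, abs_of_pos hNpos]
    exact mul_le_mul_of_nonneg_right h2.le hNpos.le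
  rw [add_mul, hq]
  rw [abs_le] at h5 ⊢
  constructor <;> linarith [h5.1, h5.2]

theorem proj_coe {k : ℕ} (α : E k) (i : Fin k) : proj α (i : ℕ) = α i := by
  unfold proj
  rw [dif_pos i.2]

theorem dist_le_sum {k : ℕ} (α β : E k) (c : ℝ) (h : ∀ i, |α i - β i| ≤ c) (hc : 0 ≤ c) :
    dist α β ≤ k * c := by
  rw [EuclideanSpace.dist_eq]
  apply Real.sqrt_le_iff.2
  refine ⟨by positivity, ?_⟩
  calc ∑ i, dist (α i) (β i) ^ 2 ≤ ∑ _i : Fin k, c ^ 2 := by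
        apply Finset.sum_le_sum
        intro i _
        rw [Real.dist_eq]
        exact pow_le_pow_left₀ (abs_nonneg _) (h i) 2
    _ = k * c ^ 2 := by simp
    _ ≤ (k * c) ^ 2 := by
        rw [mul_pow]
        apply mul_le_mul_of_nonneg_right _ (by positivity)
        have : (k : ℝ) ≤ (k : ℝ) ^ 2 := by exact_mod_cast Nat.le_self_pow two_ne_zero k
        exact this

theorem coord_le_dist {k : ℕ} (α β : E k) (i : Fin k) : |α i - β i| ≤ dist α β := by
  have := PiLp.norm_apply_le (α - β) i
  rw [dist_eq_norm]
  simpa using this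

theorem DF_near {k : ℕ} {w w' : Seq} (hw : 0 < w 0) {L : ℕ} (hL : 0 < L) (ha : Agr L w' w)
    {α : E k} (hα : α ∈ DFw k w') : ∃ β ∈ DFw k w, dist α β ≤ k * (2 / L) := by
  obtain ⟨hs, v, hv, hf⟩ := hα
  have hLpos : (0 : ℝ) < L := by exact_mod_cast hL
  obtain ⟨u, N, hN, hS, hdev⟩ := exists_dev hw hL ha hv hf (η := 1 / L) (by positivity)
  have hNpos : (0 : ℝ) < N := by exact_mod_cast hN
  have hco : ∀ i : Fin k, freqVec k u N i = (digitCount u (i : ℕ) N : ℝ) / N := fun i => rfl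
  have hβ : freqVec k u N ∈ simplex k := by
    constructor
    · intro i; rw [hco]; positivity
    · simp only [hco]
      rw [← Finset.sum_div, div_eq_one_iff_eq hNpos.ne']
      exact_mod_cast sum_digitCount u N hS.1
  refine ⟨freqVec k u N, close_mem w hβ ?_, ?_⟩
  · intro ε hε
    refine ⟨u, N, hN, hS, ?_⟩
    intro i hi
    rw [show proj (freqVec k u N) i = (digitCount u i N : ℝ) / N by
      rw [← hco ⟨i, hi⟩, ← proj_coe]]
    rw [mul_div_cancel₀ _ hNpos.ne', sub_self, abs_zero]
    positivity
  · apply dist_le_sum _ _ _ _ (by positivity)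
    intro i
    have := hdev i i.2
    rw [proj_coe] at this
    rw [hco, abs_sub_comm]
    have e : (digitCount u (i : ℕ) N : ℝ) / N - α i = ((digitCount u (i : ℕ) N : ℝ) - N * α i) / N := by
      field_simp
    rw [e, abs_div, abs_of_pos hNpos, div_le_iff₀ hNpos]
    refine this.trans (le_of_eq ?_)
    ring

theorem simplex_closed (k : ℕ) : IsClosed (simplex k) := by
  have : simplex k = (⋂ i : Fin k, {α : E k | 0 ≤ α i}) ∩ {α : E k | ∑ i, α i = 1} := by
    ext α; simp [simplex]
  rw [this]
  refine (isClosed_iInter fun i => ?_).inter ?_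
  · exact isClosed_le continuous_const (by fun_prop)
  · exact isClosed_eq (by fun_prop) continuous_const

theorem simplex_bounded (k : ℕ) : Bornology.IsBounded (simplex k) := by
  refine (Metric.isBounded_iff_subset_closedBall (0 : E k)).2 ⟨k * 1, ?_⟩
  intro α hα
  rw [Metric.mem_closedBall]
  apply dist_le_sum _ _ _ _ zero_le_one
  intro i
  have h1 := hα.1 i
  have h2 := coord_le_one hα i
  simp only [PiLp.zero_apply, sub_zero]
  rw [abs_of_nonneg h1]; exact h2

theorem DF_closed {k : ℕ} {w : Seq} (hw : 0 < w 0) : IsClosed (DFw k w) := by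
  apply isClosed_of_closure_subset
  intro α hα
  have hs : α ∈ simplex k := by
    have : closure (DFw k w) ⊆ simplex k :=
      closure_minimal (fun x hx => hx.1) (simplex_closed k)
    exact this hα
  apply close_mem w hs
  intro ε hε
  obtain ⟨β, ⟨hβ, v, hv, hf⟩, hd⟩ := Metric.mem_closure_iff.1 hα (ε / 3) (by positivity)
  obtain ⟨n, hn⟩ := exists_nat_one_div_lt (show 0 < ε / 3 by positivity)
  obtain ⟨u, N, hN, hS, hdev⟩ := exists_dev hw (L := n + 1) (by omega) (fun s _ => rfl) hv hf
    (η := ε / 3) (by positivity)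
  refine ⟨u, N, hN, hS, ?_⟩
  intro i hi
  have h1 := hdev i hi
  have h2 := (coord_le_dist α β ⟨i, hi⟩).trans hd.le
  rw [← proj_coe, ← proj_coe] at h2
  simp only at h2
  have hNpos : (0 : ℝ) < N := by exact_mod_cast hN
  push_cast at h1
  rw [abs_le] at h1 h2 ⊢
  have hn' := mul_lt_mul_of_pos_right hn hNpos
  have h3 := mul_le_mul_of_nonneg_left h2.1 hNpos.le
  have h4 := mul_le_mul_of_nonneg_left h2.2 hNpos.le
  constructor <;> nlinarith [h1.1, h1.2]

theorem DF_nonempty {k : ℕ} (hk : 2 ≤ k) {w : Seq} (hw : 0 < w 0) : (DFw k w).Nonempty := by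
  have hS : Str k w (fun _ => 0) 1 := by
    refine ⟨fun r _ => by show 0 < k; omega, fun r hr => ⟨0, by omega, by intro t ht; omega, hw⟩⟩
  have hco : ∀ i : Fin k, freqVec k (fun _ => 0) 1 i =
    (digitCount (fun _ => 0) (i : ℕ) 1 : ℝ) / (1 : ℕ) := fun i => rfl
  refine ⟨freqVec k (fun _ => 0) 1, close_mem w ?_ ?_⟩
  · constructor
    · intro i; rw [hco]; positivity
    · simp only [hco]
      rw [← Finset.sum_div, div_eq_one_iff_eq (by norm_num)]
      exact_mod_cast sum_digitCount _ 1 hS.1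
  · intro ε hε
    refine ⟨fun _ => 0, 1, one_pos, hS, ?_⟩
    intro i hi
    rw [show proj (freqVec k (fun _ => 0) 1) i = (digitCount (fun _ => 0) i 1 : ℝ) / (1 : ℕ) by
      rw [← hco ⟨i, hi⟩, ← proj_coe]]
    simp
    positivity

/-- each `DF(n)` is a nonempty compact subset of `Δ`, and `n ↦ DF(n)` is
continuous from `(N, d)` to the nonempty compact subsets of `Δ` with the Hausdorff metric. -/
theorem stmt10 (k : ℕ) (hk : 2 ≤ k) :
    (∀ m : NN, (DFN k m).Nonempty ∧ IsCompact (DFN k m) ∧ DFN k m ⊆ simplex k) ∧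
    (∀ m : NN, ∀ ε > (0 : ℝ), ∃ δ > (0 : ℝ), ∀ m' : NN, dN m' m < δ →
      Metric.hausdorffDist (DFN k m') (DFN k m) < ε) := by
  refine ⟨fun m => ⟨DF_nonempty hk (SN_zero hk m), ?_, fun α h => h.1⟩, ?_⟩
  · exact Metric.isCompact_of_isClosed_isBounded (DF_closed (SN_zero hk m))
      ((simplex_bounded k).subset fun α h => h.1)
  · intro m ε hε
    obtain ⟨n, hn⟩ := exists_nat_gt ((k : ℝ) * 2 / ε)
    have hkpos : (0 : ℝ) < k := by exact_mod_cast (by omega : 0 < k)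
    have hn0 : (0 : ℝ) < n := lt_trans (by positivity) hn
    have hn1 : 0 < n := by exact_mod_cast hn0
    obtain ⟨δ, hδ, h⟩ := SN_cont hk m n
    refine ⟨δ, hδ, fun m' hm' => ?_⟩
    have ha := h m' hm'
    have hlt : (k : ℝ) * (2 / n) < ε := by
      rw [div_lt_iff₀ hε] at hn
      rw [← mul_div_assoc, div_lt_iff₀ hn0]
      linarith
    refine lt_of_le_of_lt (Metric.hausdorffDist_le_of_mem_dist (by positivity) ?_ ?_) hlt
    · intro α hα
      exact DF_near (SN_zero hk m) hn1 ha hα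
    · intro α hα
      exact DF_near (SN_zero hk m') hn1 ha.symm' hα

end BetaDF
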